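/- Let d ≥ 0 and let x ∈ {0,1}^(4^(d+1)) be A-winnable (NAND_{2(d+1)}(x) = 1) whose root is not a fault, with consecutive quarters x^{00}, x^{01}, x^{10}, x^{11} ∈ {0,1}^(4^d). Then C_A(x^{bb'}) is finite for all b, b' ∈ {0,1}, and C_A(x) = ((C_A(x^{00}) + C_A(x^{01}))·(C_A(x^{10}) + C_A(x^{11}))) / (C_A(x^{00}) + C_A(x^{01}) + C_A(x^{10}) + C_A(x^{11})). -/

import Mathlib

open scoped ENNReal
open scoped Classical

namespace NandTree

/-- The bit-`b` half of an input of length `2^(m+1)`: `b = false` gives the first half,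
`b = true` the second half (lexicographic indexing, first bit most significant). -/
def halfInput (m : ℕ) (b : Bool) (x : Fin (2^(m+1)) → Bool) : Fin (2^m) → Bool :=
  fun i => x ⟨(cond b 1 0) * 2^m + i.val, by
    have h := i.isLt
    have h2 : (2:ℕ)^(m+1) = 2^m * 2 := pow_succ 2 m
    cases b <;> simp only [cond_true, cond_false] <;> omega⟩

/-- The value `NAND_ℓ(x)` of a depth-`ℓ` NAND-tree instance: internal nodes at even
distance from the leaves are OR gates, at odd distance AND gates. -/
def nand : (ℓ : ℕ) → (Fin (2^ℓ) → Bool) → Bool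
  | 0, x => x ⟨0, by norm_num⟩
  | (ℓ+1), x =>
    if (ℓ+1) % 2 = 0 then
      nand ℓ (halfInput ℓ false x) || nand ℓ (halfInput ℓ true x)
    else
      nand ℓ (halfInput ℓ false x) && nand ℓ (halfInput ℓ true x)

/-- Index of a leaf given by a root-to-leaf bit string (lexicographic, first bit most
significant). -/
def leafIdx (s : List Bool) : ℕ := s.foldl (fun n b => 2 * n + cond b 1 0) 0

/-- The value of the leaf reached by bit string `s` in instance `x`. -/
def leafVal (m : ℕ) (x : Fin (2^m) → Bool) (s : List Bool) : Bool :=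
  if h : leafIdx s < 2^m then x ⟨leafIdx s, h⟩ else false

/-- The root-to-leaf path determined by strategies `σA`, `σB` (each assigning a choice of
child to every node, nodes being given by the list of choices from the root): at a node
at distance `m+1` from the leaves, Player A chooses a child if `m+1` is even, else
Player B chooses. -/
def gamePath (σA σB : List Bool → Bool) : (m : ℕ) → List Bool → List Bool
  | 0, p => p
  | (m+1), p => gamePath σA σB m (p ++ [if (m+1) % 2 = 0 then σA p else σB p])

/-- `winning Z m x σ`: strategy `σ` is a winning strategy for player `Z` (`true` = A,
`false` = B) in the two-player game on the depth-`m` instance `x`: against every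
opponent strategy, the reached leaf has value `Z` (A wins on `1 = true`, B on
`0 = false`). -/
def winning (Z : Bool) (m : ℕ) (x : Fin (2^m) → Bool) (σ : List Bool → Bool) : Prop :=
  ∀ τ : List Bool → Bool,
    leafVal m x (gamePath (if Z then σ else τ) (if Z then τ else σ) m []) = Z

mutual

/-- The criticality `c(v)` of the root of a depth-`m` subtree with input `y`. -/
noncomputable def crit : (m : ℕ) → (Fin (2^m) → Bool) → ℝ≥0∞
  | 0, _ => 1
  | 1, y => if y ⟨0, by norm_num⟩ = y ⟨1, by norm_num⟩ then 1 else 2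
  | (m+2), y =>
    if nand (m+2) y ≠ decide ((m+2) % 2 = 0) then 1
    else if nand (m+1) (halfInput (m+1) false y) ≠ nand (m+1) (halfInput (m+1) true y) then 2
    else
      (max (CZ (decide ((m+2) % 2 = 0)) m (halfInput m false (halfInput (m+1) false y)) +
            CZ (decide ((m+2) % 2 = 0)) m (halfInput m true (halfInput (m+1) false y)))
           (CZ (decide ((m+2) % 2 = 0)) m (halfInput m false (halfInput (m+1) true y)) +
            CZ (decide ((m+2) % 2 = 0)) m (halfInput m true (halfInput (m+1) true y)))) /
      (((CZ (decide ((m+2) % 2 = 0)) m (halfInput m false (halfInput (m+1) false y)) +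
         CZ (decide ((m+2) % 2 = 0)) m (halfInput m true (halfInput (m+1) false y))) +
        ((CZ (decide ((m+2) % 2 = 0)) m (halfInput m false (halfInput (m+1) true y)) +
          CZ (decide ((m+2) % 2 = 0)) m (halfInput m true (halfInput (m+1) true y))))) / 2)
termination_by m _ => (m, 0)

/-- The expected product, over the random choices of `Z`'s opponent, of the criticalities
of the nodes at which `Z` moves along the path played according to strategy `σ`. -/
noncomputable def pathProd (Z : Bool) :
    (σ : List Bool → Bool) → (m : ℕ) → (Fin (2^m) → Bool) → ℝ≥0∞
  | _, 0, _ => 1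
  | σ, (m+1), y =>
    if decide ((m+1) % 2 = 0) = Z then
      crit (m+1) y * pathProd Z (fun q => σ (σ [] :: q)) m (halfInput m (σ []) y)
    else
      (pathProd Z (fun q => σ (false :: q)) m (halfInput m false y) +
       pathProd Z (fun q => σ (true :: q)) m (halfInput m true y)) / 2
termination_by _ m _ => (m, 1)

/-- The average choice complexity `C_Z` of a depth-`m` instance `y` for player `Z`
(`true` = A, `false` = B): the infimum, over `Z`-winning strategies, of the expected
product of criticalities over the nodes where `Z` moves (and `∞` if `Z` has no winning
strategy, the infimum over the empty set being `⊤`). -/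
noncomputable def CZ (Z : Bool) (m : ℕ) (y : Fin (2^m) → Bool) : ℝ≥0∞ :=
  ⨅ σ ∈ {σ : List Bool → Bool | winning Z m y σ}, pathProd Z σ m y
termination_by (m, 2)

end

lemma leafIdx_foldl (s : List Bool) (n : ℕ) :
    s.foldl (fun n b => 2 * n + cond b 1 0) n = n * 2 ^ s.length + leafIdx s := by
  induction s generalizing n with
  | nil => simp [leafIdx]
  | cons b s ih =>
    have e : leafIdx (b :: s) = (cond b 1 0) * 2 ^ s.length + leafIdx s := by
      show List.foldl _ (2 * 0 + cond b 1 0) s = _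
      rw [ih]; simp
    rw [e, List.foldl_cons, ih, List.length_cons, pow_succ]
    ring

lemma leafIdx_cons (b : Bool) (s : List Bool) :
    leafIdx (b :: s) = (cond b 1 0) * 2 ^ s.length + leafIdx s := by
  show List.foldl _ (2 * 0 + cond b 1 0) s = _
  rw [leafIdx_foldl]; simp

lemma leafIdx_lt (s : List Bool) : leafIdx s < 2 ^ s.length := by
  induction s with
  | nil => simp [leafIdx]
  | cons b s ih =>
    rw [leafIdx_cons, List.length_cons, pow_succ]
    cases b <;> simp <;> omega

lemma leafVal_cons (m : ℕ) (x : Fin (2^(m+1)) → Bool) (b : Bool) (s : List Bool)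
    (hs : s.length = m) : leafVal (m+1) x (b :: s) = leafVal m (halfInput m b x) s := by
  subst hs
  have h1 := leafIdx_lt s
  have h2 := leafIdx_lt (b :: s)
  rw [List.length_cons] at h2
  unfold leafVal
  rw [dif_pos h1, dif_pos h2]
  simp only [halfInput, leafIdx_cons]

lemma gamePath_cons (σA σB : List Bool → Bool) (m : ℕ) (b : Bool) (p : List Bool) :
    gamePath σA σB m (b :: p) =
      b :: gamePath (fun q => σA (b :: q)) (fun q => σB (b :: q)) m p := by
  induction m generalizing p with
  | zero => rfl
  | succ m ih => simp only [gamePath, List.cons_append, ih]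

lemma gamePath_length (σA σB : List Bool → Bool) (m : ℕ) (p : List Bool) :
    (gamePath σA σB m p).length = m + p.length := by
  induction m generalizing p with
  | zero => simp [gamePath]
  | succ m ih => simp only [gamePath, ih, List.length_append, List.length_singleton]; omega

lemma leafVal_gamePath (m : ℕ) (x : Fin (2^(m+1)) → Bool) (σA σB : List Bool → Bool)
    (b : Bool) (hb : (if (m+1) % 2 = 0 then σA [] else σB []) = b) :
    leafVal (m+1) x (gamePath σA σB (m+1) []) =
      leafVal m (halfInput m b x)
        (gamePath (fun q => σA (b :: q)) (fun q => σB (b :: q)) m []) := by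
  rw [gamePath, hb, List.nil_append, gamePath_cons, leafVal_cons]
  simp [gamePath_length]

/-- Strategy playing `b` at the root and `f c` in the child `c`. -/
def consStrat (b : Bool) (f : Bool → List Bool → Bool) : List Bool → Bool
  | [] => b
  | c :: q => f c q

lemma winning_own {Z : Bool} {m : ℕ} (hZ : decide ((m+1) % 2 = 0) = Z)
    (x : Fin (2^(m+1)) → Bool) (σ : List Bool → Bool) :
    winning Z (m+1) x σ ↔
      winning Z m (halfInput m (σ []) x) (fun q => σ (σ [] :: q)) := by
  subst hZ
  unfold winning
  constructor
  · intro h τ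
    have := h (consStrat false fun _ => τ)
    rw [leafVal_gamePath _ _ _ _ (σ [])] at this
    · by_cases he : (m+1) % 2 = 0 <;> simpa [he, consStrat] using this
    · by_cases he : (m+1) % 2 = 0 <;> simp [he]
  · intro h τ
    have := h (fun q => τ (σ [] :: q))
    rw [leafVal_gamePath _ _ _ _ (σ [])]
    · by_cases he : (m+1) % 2 = 0 <;> simpa [he] using this
    · by_cases he : (m+1) % 2 = 0 <;> simp [he]

lemma winning_opp {Z : Bool} {m : ℕ} (hZ : decide ((m+1) % 2 = 0) ≠ Z)
    (x : Fin (2^(m+1)) → Bool) (σ : List Bool → Bool) :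
    winning Z (m+1) x σ ↔
      ∀ b, winning Z m (halfInput m b x) (fun q => σ (b :: q)) := by
  obtain rfl : Z = !decide ((m+1) % 2 = 0) := by
    revert hZ; cases Z <;> cases decide ((m+1) % 2 = 0) <;> simp
  unfold winning
  constructor
  · intro h b τ
    have := h (consStrat b fun _ => τ)
    rw [leafVal_gamePath _ _ _ _ b] at this
    · by_cases he : (m+1) % 2 = 0 <;> simpa [he, consStrat] using this
    · by_cases he : (m+1) % 2 = 0 <;> simp [he, consStrat]
  · intro h τ
    have := h (τ []) (fun q => τ (τ [] :: q))
    rw [leafVal_gamePath _ _ _ _ (τ [])]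
    · by_cases he : (m+1) % 2 = 0 <;> simpa [he] using this
    · by_cases he : (m+1) % 2 = 0 <;> simp [he]

lemma max_div_le (a b : ℝ≥0∞) : max a b / ((a + b) / 2) ≤ 2 := by
  apply ENNReal.div_le_of_le_mul
  rw [ENNReal.mul_div_cancel (by simp) (by simp)]
  exact max_le le_self_add le_add_self

lemma crit_ne_top (m : ℕ) (y : Fin (2^m) → Bool) : crit m y ≠ ⊤ := by
  have : crit m y ≤ 2 := by
    match m, y with
    | 0, y => rw [crit]; norm_num
    | 1, y => rw [crit]; split_ifs <;> norm_num
    | m+2, y =>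
      rw [crit]
      split_ifs
      · norm_num
      · norm_num
      · exact max_div_le _ _
  exact ne_top_of_le_ne_top (by simp) this

lemma CZ_eq (Z : Bool) (m : ℕ) (y : Fin (2^m) → Bool) :
    CZ Z m y = ⨅ σ : {σ : List Bool → Bool // winning Z m y σ}, pathProd Z σ.1 m y := by
  rw [CZ, iInf_subtype]; rfl

lemma CZ_le {Z : Bool} {m : ℕ} {y : Fin (2^m) → Bool} {σ : List Bool → Bool}
    (h : winning Z m y σ) : CZ Z m y ≤ pathProd Z σ m y := by
  rw [CZ]; exact iInf₂_le σ h

lemma le_CZ {Z : Bool} {m : ℕ} {y : Fin (2^m) → Bool} {a : ℝ≥0∞}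
    (h : ∀ σ, winning Z m y σ → a ≤ pathProd Z σ m y) : a ≤ CZ Z m y := by
  rw [CZ]; exact le_iInf₂ h

lemma CZ_opp {Z : Bool} {m : ℕ} (hZ : decide ((m+1) % 2 = 0) ≠ Z)
    (y : Fin (2^(m+1)) → Bool) :
    CZ Z (m+1) y =
      (CZ Z m (halfInput m false y) + CZ Z m (halfInput m true y)) / 2 := by
  apply le_antisymm
  · rw [ENNReal.le_div_iff_mul_le (by simp) (by simp)]
    rw [CZ_eq Z m, CZ_eq Z m, ENNReal.iInf_add]
    refine le_iInf fun σ => ?_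
    rw [ENNReal.add_iInf]
    refine le_iInf fun τ => ?_
    rw [← ENNReal.le_div_iff_mul_le (by simp) (by simp)]
    refine (CZ_le (σ := consStrat false fun c => if c then τ.1 else σ.1) ?_).trans ?_
    · rw [winning_opp hZ]
      intro b
      cases b
      · simpa [consStrat] using σ.2
      · simpa [consStrat] using τ.2
    · rw [pathProd, if_neg hZ]
      simp [consStrat]
  · apply le_CZ
    intro σ hσ
    rw [winning_opp hZ] at hσ
    rw [pathProd, if_neg hZ]
    gcongr
    · exact CZ_le (hσ false)
    · exact CZ_le (hσ true)

lemma CZ_own_le {Z : Bool} {m : ℕ} (hZ : decide ((m+1) % 2 = 0) = Z)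
    (y : Fin (2^(m+1)) → Bool) (b : Bool) (hb : CZ Z m (halfInput m b y) ≠ ⊤) :
    CZ Z (m+1) y ≤ crit (m+1) y * CZ Z m (halfInput m b y) := by
  have hne : Nonempty {σ : List Bool → Bool // winning Z m (halfInput m b y) σ} := by
    by_contra hc
    rw [not_nonempty_iff] at hc
    exact hb (by rw [CZ_eq, iInf_of_empty])
  rw [CZ_eq Z m, ENNReal.mul_iInf (fun h => absurd h (crit_ne_top _ _))]
  refine le_iInf fun σ => ?_
  refine (CZ_le (σ := consStrat b fun _ => σ.1) ?_).trans ?_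
  · rw [winning_own hZ]
    exact σ.2
  · rw [pathProd, if_pos hZ]
    simp [consStrat]

lemma CZ_own {Z : Bool} {m : ℕ} (hZ : decide ((m+1) % 2 = 0) = Z)
    (y : Fin (2^(m+1)) → Bool) (hb : ∀ b, CZ Z m (halfInput m b y) ≠ ⊤) :
    CZ Z (m+1) y = crit (m+1) y *
      min (CZ Z m (halfInput m false y)) (CZ Z m (halfInput m true y)) := by
  apply le_antisymm
  · rcases min_choice (CZ Z m (halfInput m false y)) (CZ Z m (halfInput m true y)) with h | h <;>
      rw [h] <;> exact CZ_own_le hZ y _ (hb _)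
  · apply le_CZ
    intro σ hσ
    rw [winning_own hZ] at hσ
    rw [pathProd, if_pos hZ]
    gcongr
    refine le_trans ?_ (CZ_le hσ)
    cases σ []
    · exact min_le_left _ _
    · exact min_le_right _ _

lemma CZ_ne_top (m : ℕ) (Z : Bool) (y : Fin (2^m) → Bool) (h : nand m y = Z) :
    CZ Z m y ≠ ⊤ := by
  induction m with
  | zero =>
    have hw : winning Z 0 y (fun _ => false) := by
      intro τ
      simpa [leafVal, gamePath, leafIdx, nand] using h
    refine ne_top_of_le_ne_top ?_ (CZ_le hw)
    rw [pathProd]; simp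
  | succ m ih =>
    by_cases hZ : decide ((m+1) % 2 = 0) = Z
    · have : ∃ b, nand m (halfInput m b y) = Z := by
        rw [nand] at h
        by_cases he : (m+1) % 2 = 0
        · simp [he] at hZ
          subst hZ
          simpa [he] using h
        · simp [he] at hZ
          subst hZ
          simp only [he, if_false] at h
          rcases Bool.and_eq_false_iff.1 h with h | h
          · exact ⟨false, h⟩
          · exact ⟨true, h⟩
      obtain ⟨b, hb⟩ := this
      exact ne_top_of_le_ne_top (ENNReal.mul_ne_top (crit_ne_top _ _) (ih _ hb))
        (CZ_own_le hZ y b (ih _ hb))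
    · have : ∀ b, nand m (halfInput m b y) = Z := by
        rw [nand] at h
        by_cases he : (m+1) % 2 = 0
        · simp [he] at hZ
          subst hZ
          simpa [he] using h
        · simp [he] at hZ
          subst hZ
          simp only [he, if_false] at h
          simpa using h
      rw [CZ_opp hZ]
      exact ENNReal.div_ne_top (ENNReal.add_ne_top.2 ⟨ih _ (this _), ih _ (this _)⟩) (by simp)

lemma arith (a b : ℝ≥0∞) (ha : a ≠ ⊤) (hb : b ≠ ⊤) :
    max a b / ((a + b) / 2) * min (a / 2) (b / 2) = a * b / (a + b) := by
  have hm : min (a / 2) (b / 2) = min a b / 2 := by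
    rcases le_total a b with h | h
    · rw [min_eq_left h, min_eq_left (ENNReal.div_le_div_right h 2)]
    · rw [min_eq_right h, min_eq_right (ENNReal.div_le_div_right h 2)]
  rw [hm, ← max_mul_min a b]
  by_cases h0 : a + b = 0
  · obtain ⟨rfl, rfl⟩ := add_eq_zero.1 h0
    simp
  have ht : a + b ≠ ⊤ := ENNReal.add_ne_top.2 ⟨ha, hb⟩
  simp only [div_eq_mul_inv]
  rw [ENNReal.mul_inv (by simp) (by simp), inv_inv]
  have h2 : (2 : ℝ≥0∞) * 2⁻¹ = 1 := ENNReal.mul_inv_cancel (by simp) (by simp)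
  calc max a b * ((a + b)⁻¹ * 2) * (min a b * 2⁻¹)
      = max a b * min a b * (a + b)⁻¹ * (2 * 2⁻¹) := by ring
    _ = _ := by rw [h2, mul_one]

/-- For an A-winnable `x` of depth `2(d+1)` whose root is not a fault,
all four quarter complexities are finite and
`C_A(x) = ((C_A(x^{00})+C_A(x^{01}))·(C_A(x^{10})+C_A(x^{11}))) /
(C_A(x^{00})+C_A(x^{01})+C_A(x^{10})+C_A(x^{11}))`. -/
theorem CA_no_fault_recursion (d : ℕ) (x : Fin (2^(2*d+2)) → Bool)
    (h : nand (2*d+2) x = true)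
    (hnofault : nand (2*d+1) (halfInput (2*d+1) false x)
              = nand (2*d+1) (halfInput (2*d+1) true x)) :
    (∀ b b' : Bool, CZ true (2*d) (halfInput (2*d) b' (halfInput (2*d+1) b x)) ≠ ⊤) ∧
    CZ true (2*d+2) x =
      ((CZ true (2*d) (halfInput (2*d) false (halfInput (2*d+1) false x)) +
        CZ true (2*d) (halfInput (2*d) true (halfInput (2*d+1) false x))) *
       (CZ true (2*d) (halfInput (2*d) false (halfInput (2*d+1) true x)) +
        CZ true (2*d) (halfInput (2*d) true (halfInput (2*d+1) true x)))) /
      (CZ true (2*d) (halfInput (2*d) false (halfInput (2*d+1) false x)) +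
       CZ true (2*d) (halfInput (2*d) true (halfInput (2*d+1) false x)) +
       CZ true (2*d) (halfInput (2*d) false (halfInput (2*d+1) true x)) +
       CZ true (2*d) (halfInput (2*d) true (halfInput (2*d+1) true x))) := by
  have he : (2*d+1+1) % 2 = 0 := by omega
  have ho : (2*d+1) % 2 ≠ 0 := by omega
  have h1 : ∀ b, nand (2*d+1) (halfInput (2*d+1) b x) = true := by
    have h' := h
    rw [nand, if_pos he, ← hnofault, Bool.or_self] at h'
    intro b
    cases b
    · exact h'
    · rw [← hnofault]; exact h'
  have h2 : ∀ b b', nand (2*d) (halfInput (2*d) b' (halfInput (2*d+1) b x)) = true := by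
    intro b b'
    have := h1 b
    rw [nand, if_neg ho, Bool.and_eq_true] at this
    cases b'
    · exact this.1
    · exact this.2
  have hf : ∀ b b' : Bool,
      CZ true (2*d) (halfInput (2*d) b' (halfInput (2*d+1) b x)) ≠ ⊤ :=
    fun b b' => CZ_ne_top _ _ _ (h2 b b')
  refine ⟨hf, ?_⟩
  have hd : decide ((2*d+2) % 2 = 0) = true := decide_eq_true he
  rw [CZ_own (m := 2*d+1) hd x (fun b => CZ_ne_top _ _ _ (h1 b)),
    CZ_opp (by simp), CZ_opp (by simp), crit, hd, if_neg (by simpa using h),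
    if_neg (by simpa using hnofault),
    arith _ _ (ENNReal.add_ne_top.2 ⟨hf _ _, hf _ _⟩) (ENNReal.add_ne_top.2 ⟨hf _ _, hf _ _⟩)]
  simp only [add_assoc]

end NandTree
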